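/- arXiv:1210.1460 — 3 statements merged into one kernel-verified Lean document; each statement's English description precedes it below -/
import Mathlib

section
/- Rayleigh's monotonicity law: let G=(V,E) be a finite simple connected graph and let R, R': E→(0,∞) be two assignments of edge resistances with R(e) ≤ R'(e) for every edge e. Then for all vertices a, b, the effective resistances satisfy Reff_R(a,b) ≤ Reff_{R'}(a,b). -/
open scoped BigOperators

/-- The divergence of `j` at `x`: the sum of `j x y` over the neighbors `y` of `x`. -/
noncomputable def flowDiv {V : Type*} (G : SimpleGraph V) (j : V → V → ℝ) (x : V) : ℝ :=
  ∑ᶠ y ∈ G.neighborSet x, j x y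

/-- A flow from `a` to `b`: antisymmetric, supported on edges, divergence-free away
from `a` and `b`. -/
def IsFlow {V : Type*} (G : SimpleGraph V) (a b : V) (j : V → V → ℝ) : Prop :=
  (∀ x y, j x y = - j y x) ∧
  (∀ x y, ¬ G.Adj x y → j x y = 0) ∧
  (∀ x, x ≠ a → x ≠ b → flowDiv G j x = 0)

/-- A unit flow from `a` to `b`: a flow with `div_j(a) = 1`. -/
def IsUnitFlow {V : Type*} (G : SimpleGraph V) (a b : V) (j : V → V → ℝ) : Prop :=
  IsFlow G a b j ∧ flowDiv G j a = 1

/-- The energy `(1/2) Σ_{x∼y} R({x,y}) j(x,y)²`, summed over ordered adjacent pairs. -/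
noncomputable def energy {V : Type*} (G : SimpleGraph V) (R : Sym2 V → ℝ)
    (j : V → V → ℝ) : ℝ :=
  (1 / 2) * ∑ᶠ x, ∑ᶠ y ∈ G.neighborSet x, R s(x, y) * (j x y) ^ 2

open Classical in
/-- The effective resistance: the infimum of the energies of unit flows from `a` to `b`,
with `Reff(a,a) = 0`. -/
noncomputable def Reff {V : Type*} (G : SimpleGraph V) (R : Sym2 V → ℝ) (a b : V) : ℝ :=
  if a = b then 0 else sInf {E | ∃ j, IsUnitFlow G a b j ∧ E = energy G R j}

lemma finsum_mem_eq_fin {V : Type*} [Fintype V] (s : Set V) [DecidablePred (· ∈ s)]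
    (f : V → ℝ) : ∑ᶠ y ∈ s, f y = ∑ y, if y ∈ s then f y else 0 := by
  rw [finsum_eq_sum_of_fintype]
  refine Finset.sum_congr rfl fun y _ => ?_
  by_cases h : y ∈ s <;> simp [h]

open Classical in
lemma energy_eq_sum {V : Type*} [Fintype V] (G : SimpleGraph V) (R : Sym2 V → ℝ)
    (j : V → V → ℝ) : energy G R j =
      (1 / 2) * ∑ x, ∑ y, if y ∈ G.neighborSet x then R s(x, y) * (j x y) ^ 2 else 0 := by
  unfold energy
  rw [finsum_eq_sum_of_fintype]
  simp only [finsum_mem_eq_fin]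

lemma energy_nonneg {V : Type*} [Fintype V] (G : SimpleGraph V) (R : Sym2 V → ℝ)
    (hR : ∀ e ∈ G.edgeSet, 0 < R e) (j : V → V → ℝ) : 0 ≤ energy G R j := by
  rw [energy_eq_sum]
  refine mul_nonneg (by norm_num) (Finset.sum_nonneg fun x _ => Finset.sum_nonneg fun y _ => ?_)
  split_ifs with h
  · exact mul_nonneg (hR _ h).le (sq_nonneg _)
  · exact le_rfl

lemma energy_mono {V : Type*} [Fintype V] (G : SimpleGraph V) (R R' : Sym2 V → ℝ)
    (hle : ∀ e ∈ G.edgeSet, R e ≤ R' e) (j : V → V → ℝ) : energy G R j ≤ energy G R' j := by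
  rw [energy_eq_sum, energy_eq_sum]
  refine mul_le_mul_of_nonneg_left
    (Finset.sum_le_sum fun x _ => Finset.sum_le_sum fun y _ => ?_) (by norm_num)
  split_ifs with h
  · exact mul_le_mul_of_nonneg_right (hle _ h) (sq_nonneg _)
  · exact le_rfl

theorem rayleigh_monotonicity {V : Type*} [Fintype V] (G : SimpleGraph V)
    (hG : G.Connected) (R R' : Sym2 V → ℝ)
    (hR : ∀ e ∈ G.edgeSet, 0 < R e) (hR' : ∀ e ∈ G.edgeSet, 0 < R' e)
    (hle : ∀ e ∈ G.edgeSet, R e ≤ R' e) :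
    ∀ a b : V, Reff G R a b ≤ Reff G R' a b := by
  intro a b
  unfold Reff
  split_ifs with hab
  · exact le_rfl
  by_cases hne : ∃ j, IsUnitFlow G a b j
  · obtain ⟨j₀, hj₀⟩ := hne
    refine le_csInf ⟨_, j₀, hj₀, rfl⟩ ?_
    rintro _ ⟨j, hj, rfl⟩
    refine le_trans (csInf_le ?_ ?_) (energy_mono G R R' hle j)
    on_goal 2 => exact ⟨j, hj, rfl⟩
    refine ⟨0, ?_⟩
    rintro _ ⟨k, _, rfl⟩
    exact energy_nonneg G R hR k
  · have h : ∀ S : Sym2 V → ℝ, {E | ∃ j, IsUnitFlow G a b j ∧ E = energy G S j} = ∅ := by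
      intro S
      ext E
      simp only [Set.mem_ofPred_eq, Set.mem_empty_iff_false, iff_false]
      rintro ⟨j, hj, _⟩
      exact hne ⟨j, hj⟩
    rw [h, h]
end

section
/- Let G=(V,E) be a finite simple connected graph with unit resistances R ≡ 1 on all edges, and let a ≠ b be vertices. Then Epidemic(a,b) ≥ d_G(a,b)²/Reff(a,b). -/
open scoped BigOperators

/-- Number of edges of the subgraph of `G` induced by the ball of radius `r` around `x`. -/
noncomputable def ballEdges {V : Type*} (G : SimpleGraph V) (x : V) (r : ℕ) : ℕ :=
  {e ∈ G.edgeSet | ∀ v ∈ e, G.dist x v ≤ r}.ncard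

/-- The epidemic quasimetric `Epidemic(x,y) = |Ω(x,d(x,y))| + |Ω(y,d(x,y))|`. -/
noncomputable def epidemic {V : Type*} (G : SimpleGraph V) (x y : V) : ℕ :=
  ballEdges G x (G.dist x y) + ballEdges G y (G.dist x y)

open Classical in
lemma flowDiv_eq_sum {V : Type*} [Fintype V] (G : SimpleGraph V) (a b : V) (j : V → V → ℝ)
    (h : IsFlow G a b j) (x : V) : flowDiv G j x = ∑ y, j x y := by
  unfold flowDiv
  rw [finsum_eq_sum_of_fintype]
  refine Finset.sum_congr rfl fun y _ => ?_
  by_cases hxy : G.Adj x y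
  · simp [hxy]
  · simp [hxy, h.2.1 x y hxy]

open Classical in
lemma energy_eq_sum_s16 {V : Type*} [Fintype V] (G : SimpleGraph V) (a b : V) (j : V → V → ℝ)
    (h : IsFlow G a b j) : energy G (fun _ => 1) j = (1 / 2) * ∑ x, ∑ y, j x y ^ 2 := by
  unfold energy
  rw [finsum_eq_sum_of_fintype]
  congr 1
  refine Finset.sum_congr rfl fun x _ => ?_
  rw [finsum_eq_sum_of_fintype]
  refine Finset.sum_congr rfl fun y _ => ?_
  by_cases hxy : G.Adj x y
  · simp [hxy]
  · simp [hxy, h.2.1 x y hxy]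

/-- the induced ball, as a spanning graph -/
def ballGraph {V : Type*} (G : SimpleGraph V) (a : V) (r : ℕ) : SimpleGraph V where
  Adj x y := G.Adj x y ∧ G.dist a x ≤ r ∧ G.dist a y ≤ r
  symm := ⟨fun _ _ h => ⟨h.1.symm, h.2.2, h.2.1⟩⟩
  loopless := ⟨fun x h => G.loopless.irrefl x h.1⟩

open Classical in
lemma ballGraph_sum {V : Type*} [Fintype V] (G : SimpleGraph V) (a : V) (r : ℕ) :
    ∑ x, ∑ y, (if (ballGraph G a r).Adj x y then (1 : ℝ) else 0) = 2 * ballEdges G a r := by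
  have h1 := (ballGraph G a r).sum_degrees_eq_twice_card_edges
  have h2 : ballEdges G a r = (ballGraph G a r).edgeFinset.card := by
    unfold ballEdges
    rw [← Set.ncard_coe_finset]
    congr 1
    ext e
    induction e using Sym2.ind with
    | _ x y =>
      rw [SimpleGraph.coe_edgeFinset, SimpleGraph.mem_edgeSet]
      simp [ballGraph]
  rw [h2]
  have h3 : ∀ x, ∑ y, (if (ballGraph G a r).Adj x y then (1 : ℝ) else 0)
      = ((ballGraph G a r).degree x : ℝ) := by
    intro x
    rw [← SimpleGraph.card_neighborFinset_eq_degree, SimpleGraph.neighborFinset_eq_filter]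
    simp
  simp_rw [h3]
  exact_mod_cast h1

open Classical in
lemma key_bound {V : Type*} [Fintype V] (G : SimpleGraph V) (hG : G.Connected) (a b : V)
    (hab : a ≠ b) (j : V → V → ℝ) (h : IsUnitFlow G a b j) :
    (G.dist a b : ℝ) ^ 2 ≤ ballEdges G a (G.dist a b) * energy G (fun _ => 1) j := by
  obtain ⟨hf, hu⟩ := h
  have hdiv := flowDiv_eq_sum G a b j hf
  have hE := energy_eq_sum_s16 G a b j hf
  have hB := ballGraph_sum G a (G.dist a b)
  set D := G.dist a b with hD
  let f : V → ℝ := fun x => ((min (G.dist a x) D : ℕ) : ℝ)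
  have hfa : f a = 0 := by simp [f]
  have hfb : f b = D := by simp [f, hD]
  -- total divergence
  have htot : ∑ x, ∑ y, j x y = 0 := by
    have h1 : ∑ x, ∑ y, j x y = ∑ x, ∑ y, j y x := Finset.sum_comm
    have h2 : ∑ x, ∑ y, j y x = - ∑ x, ∑ y, j x y := by
      simp_rw [← Finset.sum_neg_distrib]
      exact Finset.sum_congr rfl fun x _ => Finset.sum_congr rfl fun y _ => hf.1 y x
    linarith
  have hz : ∀ x, x ≠ a → x ≠ b → ∑ y, j x y = 0 := fun x h1 h2 => by
    rw [← hdiv]; exact hf.2.2 x h1 h2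
  have ha : ∑ y, j a y = 1 := by rw [← hdiv]; exact hu
  have hb : ∑ y, j b y = -1 := by
    have : ∑ x, ∑ y, j x y = ∑ y, j a y + ∑ y, j b y :=
      Fintype.sum_eq_add a b hab fun x hx => hz x hx.1 hx.2
    linarith
  have hfd : ∑ x, ∑ y, f x * j x y = -D := by
    simp_rw [← Finset.mul_sum]
    rw [Fintype.sum_eq_add a b hab fun x hx => by rw [hz x hx.1 hx.2, mul_zero]]
    rw [hfa, hfb, hb]; ring
  have hfd' : ∑ x, ∑ y, f y * j x y = D := by
    rw [Finset.sum_comm, ← neg_inj, ← hfd]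
    simp_rw [← Finset.sum_neg_distrib]
    refine Finset.sum_congr rfl fun x _ => Finset.sum_congr rfl fun y _ => ?_
    rw [hf.1 y x]; ring
  let g : V × V → ℝ := fun p => if G.Adj p.1 p.2 then f p.2 - f p.1 else 0
  have hg : ∑ p : V × V, g p * j p.1 p.2 = 2 * D := by
    rw [Fintype.sum_prod_type]
    have : ∀ x y, g (x, y) * j x y = f y * j x y - f x * j x y := by
      intro x y
      by_cases hxy : G.Adj x y
      · simp only [g, hxy, if_true]; ring
      · simp [hf.2.1 x y hxy]
    simp only [this, Finset.sum_sub_distrib, hfd, hfd']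
    ring
  have hcs := Finset.sum_mul_sq_le_sq_mul_sq Finset.univ g (fun p : V × V => j p.1 p.2)
  have hgB : ∑ p : V × V, g p ^ 2 ≤ 2 * ballEdges G a D := by
    rw [← hB, Fintype.sum_prod_type]
    refine Finset.sum_le_sum fun x _ => Finset.sum_le_sum fun y _ => ?_
    by_cases hxy : G.Adj x y
    · have t1 : G.dist a y ≤ G.dist a x + 1 := by
        have := hG.dist_triangle (u := a) (v := x) (w := y)
        rwa [SimpleGraph.dist_eq_one_iff_adj.2 hxy] at this
      have t2 : G.dist a x ≤ G.dist a y + 1 := by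
        have := hG.dist_triangle (u := a) (v := y) (w := x)
        rwa [SimpleGraph.dist_eq_one_iff_adj.2 hxy.symm] at this
      simp only [g, hxy, if_true, f]
      split_ifs with hH
      · have u1 : min (G.dist a y) D ≤ min (G.dist a x) D + 1 := by omega
        have u2 : min (G.dist a x) D ≤ min (G.dist a y) D + 1 := by omega
        have v1 : ((min (G.dist a y) D : ℕ) : ℝ) ≤ (min (G.dist a x) D : ℕ) + 1 := by
          exact_mod_cast u1
        have v2 : ((min (G.dist a x) D : ℕ) : ℝ) ≤ (min (G.dist a y) D : ℕ) + 1 := by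
          exact_mod_cast u2
        rw [sq_le_one_iff_abs_le_one, abs_le]
        constructor <;> linarith
      · have hH' : ¬ (G.dist a x ≤ D ∧ G.dist a y ≤ D) := fun h' => hH ⟨hxy, h'⟩
        have : min (G.dist a y) D = min (G.dist a x) D := by omega
        rw [this]; simp
    · simp only [g, hxy, if_false]
      split_ifs <;> norm_num
  rw [hg, Fintype.sum_prod_type (f := fun p : V × V => j p.1 p.2 ^ 2)] at hcs
  have hJ : 0 ≤ ∑ x, ∑ y, j x y ^ 2 :=
    Finset.sum_nonneg fun x _ => Finset.sum_nonneg fun y _ => sq_nonneg _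
  have := mul_le_mul_of_nonneg_right hgB hJ
  rw [hE]
  simp only at hcs
  linarith

theorem epidemic_ge_dist_sq_div_reff {V : Type*} [Fintype V]
    (G : SimpleGraph V) (hG : G.Connected) (a b : V) (hab : a ≠ b) :
    (epidemic G a b : ℝ) ≥ (G.dist a b : ℝ) ^ 2 / Reff G (fun _ => 1) a b := by
  have hsub : (ballEdges G a (G.dist a b) : ℝ) ≤ epidemic G a b := by
    unfold epidemic; push_cast; simp
  refine le_trans ?_ hsub
  rcases le_or_gt (Reff G (fun _ => 1) a b) 0 with h0 | hpos
  · exact (div_nonpos_of_nonneg_of_nonpos (sq_nonneg _) h0).trans (Nat.cast_nonneg _)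
  rw [div_le_iff₀ hpos]
  simp only [Reff, if_neg hab] at hpos ⊢
  have hne : {E | ∃ j, IsUnitFlow G a b j ∧ E = energy G (fun _ => 1) j}.Nonempty := by
    by_contra hne
    rw [Set.not_nonempty_iff_eq_empty] at hne
    rw [hne, Real.sInf_empty] at hpos
    exact lt_irrefl _ hpos
  rcases Nat.eq_zero_or_pos (ballEdges G a (G.dist a b)) with hB | hB
  · obtain ⟨E, j, hj, rfl⟩ := hne
    have := key_bound G hG a b hab j hj
    rw [hB] at this ⊢
    simpa using this
  · have hB' : (0 : ℝ) < ballEdges G a (G.dist a b) := by exact_mod_cast hB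
    rw [← div_le_iff₀' hB']
    refine le_csInf hne ?_
    rintro E ⟨j, hj, rfl⟩
    rw [div_le_iff₀' hB']
    exact key_bound G hG a b hab j hj
end

section
/- Let N ≥ 2 and let G be the graph obtained from the complete graph K_N by adjoining one new vertex b joined by a single edge to a fixed vertex a of K_N, with unit resistances R ≡ 1 on all edges. Then d_G(a,b) = 1, Reff(a,b) = 1, and Epidemic(a,b) = N(N−1)/2 + 2. Consequently the discrepancy δ(a,b) := Reff(a,b)·Epidemic(a,b)/d_G(a,b)² equals N(N−1)/2 + 2, which grows quadratically in the number of vertices. -/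
open scoped BigOperators

/-- The complete graph `K_N` (on `some`-vertices) together with one extra vertex `none`
joined by a single edge to the fixed vertex `some ⟨0, _⟩` of `K_N`. -/
def completePlusPendant (N : ℕ) : SimpleGraph (Option (Fin N)) :=
  SimpleGraph.fromRel (fun u v =>
    (∃ i j : Fin N, u = some i ∧ v = some j) ∨
    (u = none ∧ ∃ h : 0 < N, v = some ⟨0, h⟩))


lemma cpp_adj_some (N : ℕ) (i j : Fin N) : (completePlusPendant N).Adj (some i) (some j) ↔ i ≠ j := by
  simp [completePlusPendant]

lemma cpp_adj_none (N : ℕ) (hN : 0 < N) (v : Option (Fin N)) :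
    (completePlusPendant N).Adj none v ↔ v = some ⟨0, hN⟩ := by
  cases v <;> simp [completePlusPendant, hN]

lemma cpp_edges (N : ℕ) (hN : 0 < N) : (completePlusPendant N).edgeSet =
    insert s(none, some ⟨0, hN⟩) (Sym2.map some '' (⊤ : SimpleGraph (Fin N)).edgeSet) := by
  ext e
  induction e with
  | _ u v =>
  rw [SimpleGraph.mem_edgeSet, Set.mem_insert_iff]
  constructor
  · intro h
    cases u with
    | none => left; rw [(cpp_adj_none N hN v).1 h]
    | some i =>
      cases v with
      | none => left; rw [(cpp_adj_none N hN _).1 h.symm, Sym2.eq_swap]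
      | some j => right; exact ⟨s(i, j), by simpa using (cpp_adj_some N i j).1 h, rfl⟩
  · rintro (h | ⟨e, he, h⟩)
    · rw [← SimpleGraph.mem_edgeSet, h, SimpleGraph.mem_edgeSet, cpp_adj_none N hN]
    · rw [← SimpleGraph.mem_edgeSet, ← h]
      induction e with
      | _ i j =>
      simpa [cpp_adj_some] using he

lemma cpp_ncard (N : ℕ) (hN : 0 < N) : (completePlusPendant N).edgeSet.ncard = N * (N - 1) / 2 + 1 := by
  rw [cpp_edges N hN, Set.ncard_insert_of_notMem, Set.ncard_image_of_injective]
  · rw [← SimpleGraph.coe_edgeFinset, Set.ncard_coe_finset, SimpleGraph.card_edgeFinset_top_eq_card_choose_two,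
      Fintype.card_fin, Nat.choose_two_right]
  · exact Sym2.map.injective (Option.some_injective _)
  · rintro ⟨e, he, h⟩
    induction e with
    | _ i j => simp at h

lemma flowDiv_eq {V : Type*} [Fintype V] (G : SimpleGraph V) (j : V → V → ℝ)
    (h : ∀ x y, ¬ G.Adj x y → j x y = 0) (x : V) : flowDiv G j x = ∑ y, j x y := by
  classical
  unfold flowDiv
  rw [finsum_eq_sum_of_fintype]
  refine Finset.sum_congr rfl fun y _ => ?_
  by_cases hy : G.Adj x y
  · simp [hy]
  · simp [hy, h x y hy]

lemma energy_eq {V : Type*} [Fintype V] (G : SimpleGraph V) (j : V → V → ℝ)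
    (h : ∀ x y, ¬ G.Adj x y → j x y = 0) :
    energy G (fun _ => 1) j = 1 / 2 * ∑ x, ∑ y, j x y ^ 2 := by
  classical
  unfold energy
  rw [finsum_eq_sum_of_fintype]
  congr 1
  refine Finset.sum_congr rfl fun x _ => ?_
  rw [finsum_eq_sum_of_fintype]
  refine Finset.sum_congr rfl fun y _ => ?_
  by_cases hy : G.Adj x y
  · simp [hy]
  · simp [hy, h x y hy]

lemma cpp_lower (N : ℕ) (hN : 0 < N) (j : Option (Fin N) → Option (Fin N) → ℝ)
    (h : IsUnitFlow (completePlusPendant N) (some ⟨0, hN⟩) none j) :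
    1 ≤ energy (completePlusPendant N) (fun _ => 1) j := by
  obtain ⟨⟨anti, supp, hdiv⟩, hu⟩ := h
  rw [energy_eq _ _ supp]
  simp only [flowDiv_eq _ _ supp] at hdiv hu
  set a : Option (Fin N) := some ⟨0, hN⟩ with ha
  have tot : ∑ x, ∑ y, j x y = 0 := by
    have h1 : ∑ x, ∑ y, j x y = ∑ x, ∑ y, - j x y := by
      rw [Finset.sum_comm]
      exact Finset.sum_congr rfl fun x _ => Finset.sum_congr rfl fun y _ => anti y x
    simp only [Finset.sum_neg_distrib] at h1
    linarith
  have hnone : ∑ y, j none y = j none a := by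
    refine Finset.sum_eq_single a (fun y _ hy => supp _ _ ?_) (by simp)
    rw [cpp_adj_none N hN]; exact hy
  have tot2 : ∑ x, ∑ y, j x y = ∑ y, j a y + ∑ y, j none y := by
    rw [← Finset.sum_pair (f := fun x => ∑ y, j x y) (show a ≠ none by simp [ha])]
    symm
    refine Finset.sum_subset (Finset.subset_univ _) fun x _ hx => ?_
    simp only [Finset.mem_insert, Finset.mem_singleton, not_or] at hx
    exact hdiv x hx.1 hx.2
  have e1 : j none a = -1 := by linarith
  have e2 : j a none = 1 := by rw [anti, e1]; norm_num
  have hp : ∑ y, j a y ^ 2 + ∑ y, j none y ^ 2 ≤ ∑ x, ∑ y, j x y ^ 2 := by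
    rw [← Finset.sum_pair (f := fun x => ∑ y, j x y ^ 2) (show a ≠ none by simp [ha])]
    exact Finset.sum_le_sum_of_subset_of_nonneg (Finset.subset_univ _)
      fun x _ _ => Finset.sum_nonneg fun y _ => sq_nonneg _
  have q1 := Finset.single_le_sum (f := fun y => j a y ^ 2) (fun y _ => sq_nonneg _) (Finset.mem_univ none)
  have q2 := Finset.single_le_sum (f := fun y => j none y ^ 2) (fun y _ => sq_nonneg _) (Finset.mem_univ a)
  simp only [e1, e2] at q1 q2
  linarith

lemma cpp_attain (N : ℕ) (hN : 0 < N) : ∃ j,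
    IsUnitFlow (completePlusPendant N) (some ⟨0, hN⟩) none j ∧
    1 = energy (completePlusPendant N) (fun _ => 1) j := by
  classical
  set a : Option (Fin N) := some ⟨0, hN⟩ with ha
  have hab : a ≠ none := by simp [ha]
  let j : Option (Fin N) → Option (Fin N) → ℝ := fun x y =>
    (if x = a then if y = none then 1 else 0 else 0) - (if x = none then if y = a then 1 else 0 else 0)
  have supp : ∀ x y, ¬ (completePlusPendant N).Adj x y → j x y = 0 := by
    intro x y h
    have h1 : ¬ (x = a ∧ y = none) := by
      rintro ⟨rfl, rfl⟩
      exact h ((cpp_adj_none N hN _).2 rfl).symm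
    have h2 : ¬ (x = none ∧ y = a) := by
      rintro ⟨rfl, rfl⟩
      exact h ((cpp_adj_none N hN _).2 rfl)
    simp only [j]
    grind
  refine ⟨j, ⟨⟨?_, supp, ?_⟩, ?_⟩, ?_⟩
  · intro x y; simp only [j]; grind
  · intro x h1 h2
    rw [flowDiv_eq _ _ supp]
    simp [j, h1, h2]
  · rw [flowDiv_eq _ _ supp]
    simp [j, hab]
  · have : ∀ x y, j x y ^ 2 = (if x = a then if y = none then 1 else 0 else 0) + (if x = none then if y = a then 1 else 0 else 0) := by
      intro x y; simp only [j]; grind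
    rw [energy_eq _ _ supp]
    simp only [this, Finset.sum_add_distrib]
    rw [Finset.sum_eq_single a (by intro b _ hb; simp [hb]) (by simp),
      Finset.sum_eq_single none (by intro b _ hb; simp [hb]) (by simp)]
    simp; norm_num

lemma cpp_reff (N : ℕ) (hN : 0 < N) :
    Reff (completePlusPendant N) (fun _ => 1) (some ⟨0, hN⟩) none = 1 := by
  rw [Reff, if_neg (by simp)]
  apply le_antisymm
  · exact csInf_le ⟨1, by rintro _ ⟨j, h, rfl⟩; exact cpp_lower N hN j h⟩ (cpp_attain N hN)
  · exact le_csInf ⟨1, cpp_attain N hN⟩ (by rintro _ ⟨j, h, rfl⟩; exact cpp_lower N hN j h)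

lemma cpp_adj_a (N : ℕ) (hN : 0 < N) (v : Option (Fin N)) (hv : v ≠ some ⟨0, hN⟩) :
    (completePlusPendant N).Adj (some ⟨0, hN⟩) v := by
  cases v with
  | none => exact ((cpp_adj_none N hN _).2 rfl).symm
  | some i => rw [cpp_adj_some]; rintro rfl; exact hv rfl

lemma cpp_conn (N : ℕ) (hN : 0 < N) : (completePlusPendant N).Connected := by
  have h : ∀ v, (completePlusPendant N).Reachable (some ⟨0, hN⟩) v := by
    intro v
    by_cases hv : v = some ⟨0, hN⟩
    · rw [hv]
    · exact (cpp_adj_a N hN v hv).reachable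
  exact { preconnected := fun u v => (h u).symm.trans (h v), nonempty := ⟨none⟩ }

lemma cpp_dist_a (N : ℕ) (hN : 0 < N) (v : Option (Fin N)) :
    (completePlusPendant N).dist (some ⟨0, hN⟩) v ≤ 1 := by
  by_cases hv : v = some ⟨0, hN⟩
  · rw [hv]; simp
  · exact (SimpleGraph.dist_eq_one_iff_adj.2 (cpp_adj_a N hN v hv)).le

lemma cpp_epi (N : ℕ) (hN : 0 < N) :
    epidemic (completePlusPendant N) (some ⟨0, hN⟩) none = N * (N - 1) / 2 + 2 := by
  have hd : (completePlusPendant N).dist (some ⟨0, hN⟩) none = 1 :=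
    SimpleGraph.dist_eq_one_iff_adj.2 (cpp_adj_a N hN none (by simp))
  have h1 : ballEdges (completePlusPendant N) (some ⟨0, hN⟩) 1 = N * (N - 1) / 2 + 1 := by
    rw [← cpp_ncard N hN, ballEdges]
    congr 1
    ext e
    simp only [Set.mem_setOf_eq, and_iff_left_iff_imp]
    exact fun _ v _ => cpp_dist_a N hN v
  have hb : ∀ v, (completePlusPendant N).dist none v ≤ 1 → v = none ∨ v = some ⟨0, hN⟩ := by
    intro v hv
    rcases Nat.le_one_iff_eq_zero_or_eq_one.1 hv with h | h
    · left; exact ((cpp_conn N hN).dist_eq_zero_iff.1 h).symm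
    · right; exact (cpp_adj_none N hN v).1 (SimpleGraph.dist_eq_one_iff_adj.1 h)
  have h2 : ballEdges (completePlusPendant N) none 1 = 1 := by
    rw [ballEdges, Set.ncard_eq_one]
    refine ⟨s(none, some ⟨0, hN⟩), ?_⟩
    ext e
    induction e with
    | _ u v =>
    simp only [Set.mem_setOf_eq, Set.mem_singleton_iff, SimpleGraph.mem_edgeSet]
    constructor
    · rintro ⟨h, hh⟩
      have hne := h.ne
      rcases hb u (hh u (by simp)) with rfl | rfl <;> rcases hb v (hh v (by simp)) with rfl | rfl
      · exact absurd rfl hne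
      · rfl
      · exact Sym2.eq_swap
      · exact absurd rfl hne
    · intro h
      constructor
      · rw [← SimpleGraph.mem_edgeSet, h, SimpleGraph.mem_edgeSet, cpp_adj_none N hN]
      · intro w hw
        rw [h, Sym2.mem_iff] at hw
        rcases hw with rfl | rfl
        · simp
        · rw [SimpleGraph.dist_comm, hd]
  rw [epidemic, hd, h1, h2]

theorem complete_plus_pendant_discrepancy (N : ℕ) (hN : 2 ≤ N) :
    let G := completePlusPendant N
    let a : Option (Fin N) := some ⟨0, by omega⟩
    let b : Option (Fin N) := none
    G.dist a b = 1 ∧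
    Reff G (fun _ => 1) a b = 1 ∧
    epidemic G a b = N * (N - 1) / 2 + 2 ∧
    Reff G (fun _ => 1) a b * (epidemic G a b : ℝ) / (G.dist a b : ℝ) ^ 2
      = (N : ℝ) * ((N : ℝ) - 1) / 2 + 2 := by
  intro G a b
  have hN0 : 0 < N := by omega
  have hd : G.dist a b = 1 :=
    SimpleGraph.dist_eq_one_iff_adj.2 (cpp_adj_a N hN0 none (by simp))
  have hr : Reff G (fun _ => 1) a b = 1 := cpp_reff N hN0
  have he : epidemic G a b = N * (N - 1) / 2 + 2 := cpp_epi N hN0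
  refine ⟨hd, hr, he, ?_⟩
  rw [hd, hr, he]
  have hc : ((N * (N - 1) / 2 : ℕ) : ℝ) = (N : ℝ) * ((N : ℝ) - 1) / 2 := by
    rw [← Nat.choose_two_right, Nat.cast_choose_two]
  rw [Nat.cast_add, hc]
  norm_num
end
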